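/- Extension of Gauss's second summation theorem: let a, b, d be complex numbers with Re(d) > 0, such that (a+b+3)/2 is not a nonpositive integer and (a−b−1)/2 is not a nonpositive integer. Then ₃F₂(a, b, d+1; (a+b+3)/2, d; 1/2) = Γ(1/2) Γ((a+b+3)/2) Γ((a−b−1)/2) / Γ((a−b+3)/2) · [ ((a+b−1)/2 − ab/d) / (Γ((a+1)/2) Γ((b+1)/2)) + ((a+b+1)/d − 2) / (Γ(a/2) Γ(b/2)) ]. -/

import Mathlib

open scoped Nat

/-- Pochhammer symbol `(x)_k = x (x+1) ⋯ (x+k-1)` for a complex number `x`. -/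
noncomputable def poch (x : ℂ) (k : ℕ) : ℂ := (ascPochhammer ℂ k).eval x

/-- The generalized hypergeometric series
`ₚF_q(a₁,…,aₚ; b₁,…,b_q; z) = ∑ₖ ((a₁)ₖ ⋯ (aₚ)ₖ)/((b₁)ₖ ⋯ (b_q)ₖ) · zᵏ/k!`. -/
noncomputable def hyp (a b : List ℂ) (z : ℂ) : ℂ :=
  ∑' k : ℕ, ((a.map (poch · k)).prod / (b.map (poch · k)).prod) * z ^ k / (k ! : ℂ)

open Filter Topology MeasureTheory

lemma poch_zero (x : ℂ) : poch x 0 = 1 := by simp [poch]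

lemma poch_succ (x : ℂ) (k : ℕ) : poch x (k + 1) = poch x k * (x + k) := by
  simp [poch, ascPochhammer_succ_eval]

lemma mul_poch_add_one (x : ℂ) (k : ℕ) : x * poch (x + 1) k = poch x k * (x + k) := by
  rw [← poch_succ]
  simp [poch, ascPochhammer_succ_left]

lemma Gamma_add_nat_eq_poch {x : ℂ} (hx : ∀ n : ℕ, x ≠ -(n : ℂ)) (k : ℕ) :
    Complex.Gamma (x + k) = poch x k * Complex.Gamma x := by
  induction k with
  | zero => simp [poch_zero]
  | succ k ih =>
    have h : x + k ≠ 0 := fun h => hx k (eq_neg_of_add_eq_zero_left h)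
    rw [Nat.cast_succ, ← add_assoc, Complex.Gamma_add_one _ h, ih, poch_succ]
    ring

lemma ne_neg_nat_of_re_pos {x : ℂ} (hx : 0 < x.re) (n : ℕ) : x ≠ -(n : ℂ) := by
  rintro rfl
  simp at hx
  linarith [(Nat.cast_nonneg n : (0 : ℝ) ≤ n)]

/-- Coefficients of the regularized hypergeometric series `₂F₁(a, b; c; 1/2) / Γ(c)`. -/
noncomputable def regCoeff (a b c : ℂ) (k : ℕ) : ℂ :=
  poch a k * poch b k * (1 / 2) ^ k / (k ! : ℂ) * (Complex.Gamma (c + k))⁻¹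

lemma inv_Gamma_eq_mul (x : ℂ) : (Complex.Gamma x)⁻¹ = x * (Complex.Gamma (x + 1))⁻¹ :=
  Complex.one_div_Gamma_eq_self_mul_one_div_Gamma_add_one x

lemma regCoeff_comm (a b c : ℂ) (k : ℕ) : regCoeff a b c k = regCoeff b a c k := by
  simp [regCoeff, mul_comm (poch a k)]

lemma regCoeff_eq_mul_add_one (a b c : ℂ) (k : ℕ) :
    regCoeff a b c k = (c + k) * regCoeff a b (c + 1) k := by
  rw [regCoeff, regCoeff, inv_Gamma_eq_mul, add_right_comm]
  ring

lemma regCoeff_succ (a b c : ℂ) (k : ℕ) :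
    (k + 1) * (c + k) * regCoeff a b c (k + 1) = (a + k) * (b + k) / 2 * regCoeff a b c k := by
  have h1 : (k : ℂ) + 1 ≠ 0 := by exact_mod_cast k.succ_ne_zero
  have h2 : (k ! : ℂ) ≠ 0 := by exact_mod_cast k.factorial_ne_zero
  rw [regCoeff, regCoeff, inv_Gamma_eq_mul (c + k), poch_succ, poch_succ, Nat.factorial_succ]
  push_cast
  rw [← add_assoc, pow_succ]
  field_simp

lemma summable_pow_mul_regCoeff (a b c : ℂ) (j : ℕ) :
    Summable fun k : ℕ => (k : ℂ) ^ j * regCoeff a b c k := by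
  have ht (x y : ℂ) : Tendsto (fun k : ℕ => (x + k) / (y + k)) atTop (𝓝 1) := by
    simpa using tendsto_add_mul_div_add_mul_atTop_nhds x y 1 (one_ne_zero (α := ℂ))
  have hlim : Tendsto (fun k : ℕ => ‖((1 + k) / (0 + k) : ℂ) ^ j * ((a + k) / (c + k)) *
      ((b + k) / (1 + k)) * (1 / 2)‖) atTop (𝓝 (1 / 2)) := by
    have := (((((ht 1 0).pow j).mul (ht a c)).mul (ht b 1)).mul_const (1 / 2)).norm
    simpa using this
  have hne (x : ℂ) : ∀ᶠ k : ℕ in atTop, x + k ≠ 0 := by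
    have := (ht x x).eventually_ne one_ne_zero
    filter_upwards [this] with k hk h
    simp [h] at hk
  refine summable_of_ratio_norm_eventually_le (r := 3 / 4) (by norm_num) ?_
  filter_upwards [hlim.eventually_le_const (by norm_num : (1 / 2 : ℝ) < 3 / 4),
    hne c, hne 0, hne 1] with k hk hc h0 h1
  refine le_trans (le_of_eq ?_) (mul_le_mul_of_nonneg_right hk (norm_nonneg _))
  rw [← norm_mul]
  congr 1
  have hs := regCoeff_succ a b c k
  have hs' : regCoeff a b c (k + 1) =
      (a + k) / (c + k) * ((b + k) / (1 + k)) * (1 / 2) * regCoeff a b c k := by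
    field_simp
    linear_combination 2 * hs
  rw [zero_add] at h0
  rw [hs', div_pow, zero_add]
  push_cast
  field_simp
  ring

/-- The moments `∑ kʲ tₖ` of the coefficients of `₂F₁(a, b; c; 1/2) / Γ(c)`. -/
noncomputable def regMoment (a b c : ℂ) (j : ℕ) : ℂ := ∑' k : ℕ, (k : ℂ) ^ j * regCoeff a b c k

lemma hasSum_regMoment (a b c : ℂ) (j : ℕ) :
    HasSum (fun k : ℕ => (k : ℂ) ^ j * regCoeff a b c k) (regMoment a b c j) :=
  (summable_pow_mul_regCoeff a b c j).hasSum

lemma hasSum_quadratic_mul_regCoeff (a b c p q r : ℂ) :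
    HasSum (fun k : ℕ => (p + q * k + r * k ^ 2) * regCoeff a b c k)
      (p * regMoment a b c 0 + q * regMoment a b c 1 + r * regMoment a b c 2) := by
  have := (((hasSum_regMoment a b c 0).mul_left p).add
    ((hasSum_regMoment a b c 1).mul_left q)).add ((hasSum_regMoment a b c 2).mul_left r)
  refine this.congr_fun ?_
  intro k
  ring

lemma regMoment_relation (a b c : ℂ) :
    a * b / 2 * regMoment a b (c + 1) 0 + ((a + b) / 2 - c) * regMoment a b (c + 1) 1
      - 1 / 2 * regMoment a b (c + 1) 2 = 0 := by
  have h1 := hasSum_quadratic_mul_regCoeff a b (c + 1) 0 c 1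
  have h2 := (hasSum_nat_add_iff' 1).mpr h1
  have h3 := hasSum_quadratic_mul_regCoeff a b (c + 1) (a * b / 2) ((a + b) / 2) (1 / 2)
  have h4 := h3.unique (h2.congr_fun fun k => by
    have := regCoeff_succ a b (c + 1) k
    push_cast
    linear_combination -this)
  simp at h4
  linear_combination h4

/-- The series `₂F₁(a, b; (a+b+1)/2; 1/2) / Γ((a+b+1)/2)`. -/
noncomputable def gaussSecondSum (a b : ℂ) : ℂ := ∑' k : ℕ, regCoeff a b ((a + b + 1) / 2) k

lemma gaussSecondSum_comm (a b : ℂ) : gaussSecondSum a b = gaussSecondSum b a := by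
  simp_rw [gaussSecondSum, regCoeff_comm a b, add_comm a b]

lemma gaussSecondSum_eq_regMoment (a b : ℂ) :
    gaussSecondSum a b = (a + b + 1) / 2 * regMoment a b ((a + b + 1) / 2 + 1) 0 +
      regMoment a b ((a + b + 1) / 2 + 1) 1 := by
  have := hasSum_quadratic_mul_regCoeff a b ((a + b + 1) / 2 + 1) ((a + b + 1) / 2) 1 0
  rw [gaussSecondSum]
  simp_rw [regCoeff_eq_mul_add_one a b ((a + b + 1) / 2)]
  simpa using this.tsum_eq

lemma mul_gaussSecondSum_add_one_add_one (a b : ℂ) :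
    a * b * gaussSecondSum (a + 1) (b + 1) = a * b * regMoment a b ((a + b + 1) / 2 + 1) 0 +
      (a + b) * regMoment a b ((a + b + 1) / 2 + 1) 1 +
      regMoment a b ((a + b + 1) / 2 + 1) 2 := by
  have := hasSum_quadratic_mul_regCoeff a b ((a + b + 1) / 2 + 1) (a * b) (a + b) 1
  rw [one_mul] at this
  rw [← this.tsum_eq, gaussSecondSum, ← tsum_mul_left]
  congr 1 with k
  rw [regCoeff, regCoeff, show (a + 1 + (b + 1) + 1) / 2 = (a + b + 1) / 2 + 1 by ring]
  linear_combination ((1 / 2) ^ k / (k ! : ℂ) * (Complex.Gamma ((a + b + 1) / 2 + 1 + k))⁻¹) *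
    (b * poch (b + 1) k * mul_poch_add_one a k + poch a k * (a + k) * mul_poch_add_one b k)

lemma gaussSecondSum_zero_left (b : ℂ) : gaussSecondSum 0 b = (Complex.Gamma ((b + 1) / 2))⁻¹ := by
  rw [gaussSecondSum, tsum_eq_single 0]
  · simp [regCoeff, poch]
  · intro k hk
    simp [regCoeff, poch, hk]

lemma gaussSecondSum_eq_mul_add_two (a b : ℂ) (ha : a ≠ 0) :
    gaussSecondSum a b = (a + 1) / 2 * gaussSecondSum (a + 2) b := by
  have h : a * (a + 1) * gaussSecondSum (a + 2) b =
      a * (a + 1) * regMoment a b ((a + b + 1) / 2 + 1) 0 +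
      (2 * a + 1) * regMoment a b ((a + b + 1) / 2 + 1) 1 +
      regMoment a b ((a + b + 1) / 2 + 1) 2 := by
    have := hasSum_quadratic_mul_regCoeff a b ((a + b + 1) / 2 + 1) (a * (a + 1)) (2 * a + 1) 1
    rw [one_mul] at this
    rw [← this.tsum_eq, gaussSecondSum, ← tsum_mul_left]
    congr 1 with k
    rw [regCoeff, regCoeff, show (a + 2 + b + 1) / 2 = (a + b + 1) / 2 + 1 by ring]
    have h1 := mul_poch_add_one a k
    have h2 := mul_poch_add_one (a + 1) k
    rw [show a + 1 + 1 = a + 2 by ring] at h2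
    linear_combination (poch b k * (1 / 2) ^ k / (k ! : ℂ) *
      (Complex.Gamma ((a + b + 1) / 2 + 1 + k))⁻¹) * (a * h2 + (a + 1 + k) * h1)
  have h0 := regMoment_relation a b ((a + b + 1) / 2)
  have h1 := gaussSecondSum_eq_regMoment a b
  refine mul_left_cancel₀ ha ?_
  linear_combination a * h1 - h / 2 + h0

lemma hasSum_one_sub_cpow_neg (a : ℂ) {z : ℂ} (hz : ‖z‖ < 1) :
    HasSum (fun k : ℕ => poch a k / (k ! : ℂ) * z ^ k) ((1 - z) ^ (-a)) := by
  have h := (Complex.one_div_one_sub_cpow_hasFPowerSeriesOnBall_zero a).hasSum (y := z)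
    (by simpa [Metric.mem_eball, edist_zero_right, enorm_eq_nnnorm] using! hz)
  rw [zero_add, one_div, ← Complex.cpow_neg] at h
  refine h.congr_fun fun k => ?_
  have h2 := Ring.factorial_nsmul_multichoose_eq_ascPochhammer a k
  rw [Polynomial.ascPochhammer_smeval_eq_eval, nsmul_eq_mul, Ring.multichoose_eq] at h2
  have h3 : (k ! : ℂ) ≠ 0 := by exact_mod_cast k.factorial_ne_zero
  rw [FormalMultilinearSeries.ofScalars_apply_eq, poch, ← h2]
  simp [h3]

open Complex in
lemma integral_eq_betaIntegral (b v : ℂ) :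
    ∫ t : ℝ in 0..1, (t : ℂ) ^ (b - 1) * (1 - (t : ℂ)) ^ (v - 1) *
      (1 - (t : ℂ) / 2) ^ (-(2 * v + b - 1)) = 2 ^ (b - 1) * betaIntegral (b / 2) v := by
  have himg : (fun t : ℝ => (t / (2 - t)) ^ 2) '' Set.Ioo 0 1 = Set.Ioo 0 1 := by
    ext s
    constructor
    · rintro ⟨t, ⟨h0, h1⟩, rfl⟩
      have h2 : 0 < 2 - t := by linarith
      have h3 : 0 < t / (2 - t) := by positivity
      have h4 : t / (2 - t) < 1 := by rw [div_lt_one h2]; linarith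
      exact ⟨by positivity, by dsimp only; nlinarith⟩
    · rintro ⟨h0, h1⟩
      have h2 : 0 < √s := Real.sqrt_pos.mpr h0
      have h3 : √s < 1 := by rw [Real.sqrt_lt' one_pos]; simpa using h1
      refine ⟨2 * √s / (1 + √s), ⟨by positivity, by rw [div_lt_one (by positivity)]; linarith⟩, ?_⟩
      have h4 : 2 * √s / (1 + √s) / (2 - 2 * √s / (1 + √s)) = √s := by
        have : 2 - 2 * √s / (1 + √s) = 2 / (1 + √s) := by field_simp; ring
        rw [this]
        field_simp
      simp only [h4, Real.sq_sqrt h0.le]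
  have hinj : Set.InjOn (fun t : ℝ => (t / (2 - t)) ^ 2) (Set.Ioo 0 1) := by
    rintro x ⟨hx0, hx1⟩ y ⟨hy0, hy1⟩ hxy
    have hx2 : 0 < 2 - x := by linarith
    have hy2 : 0 < 2 - y := by linarith
    have h := (pow_left_inj₀ (by positivity) (by positivity) two_ne_zero).mp hxy
    rw [div_eq_div_iff hx2.ne' hy2.ne'] at h
    linarith
  have hder : ∀ t ∈ Set.Ioo (0 : ℝ) 1, HasDerivWithinAt (fun t : ℝ => (t / (2 - t)) ^ 2)
      (4 * t / (2 - t) ^ 3) (Set.Ioo 0 1) t := by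
    rintro t ⟨h0, h1⟩
    have h2 : 2 - t ≠ 0 := by linarith
    have := (((hasDerivAt_id t).div ((hasDerivAt_id t).const_sub 2) h2).pow 2).hasDerivWithinAt
      (s := Set.Ioo 0 1)
    refine (this.congr_deriv ?_)
    simp
    field_simp
    ring
  rw [betaIntegral, intervalIntegral.integral_of_le zero_le_one,
    intervalIntegral.integral_of_le zero_le_one, integral_Ioc_eq_integral_Ioo,
    integral_Ioc_eq_integral_Ioo]
  conv_rhs => rw [← himg, integral_image_eq_integral_abs_deriv_smul measurableSet_Ioo hder hinj]
  rw [← integral_const_mul]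
  refine setIntegral_congr_fun measurableSet_Ioo ?_
  rintro t ⟨h0, h1⟩
  have h2 : 0 < 2 - t := by linarith
  have h3 : 0 < 1 - t := by linarith
  have h4 : 0 < 1 - t / 2 := by linarith
  have h5 : 1 - (t / (2 - t)) ^ 2 = 4 * (1 - t) / (2 - t) ^ 2 := by field_simp; ring
  have key (x : ℝ) (hx : 0 < x) (z : ℂ) : (x : ℂ) ^ z = exp (Real.log x * z) := by
    rw [cpow_def_of_ne_zero (by exact_mod_cast hx.ne'), ofReal_log hx.le]
  have e1 : (1 : ℂ) - t = ((1 - t : ℝ) : ℂ) := by push_cast; ring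
  have e2 : (1 : ℂ) - (t : ℂ) / 2 = (((2 - t) / 2 : ℝ) : ℂ) := by push_cast; ring
  have e3 : (1 : ℂ) - (((t / (2 - t)) ^ 2 : ℝ) : ℂ) = ((4 * (1 - t) / (2 - t) ^ 2 : ℝ) : ℂ) := by
    rw [← h5]; push_cast; ring
  have l4 : Real.log 4 = 2 * Real.log 2 := by
    rw [show (4 : ℝ) = 2 ^ 2 by norm_num, Real.log_pow]; norm_num
  have e4 : 4 * t / (2 - t) ^ 3 =
      Real.exp (2 * Real.log 2 + Real.log t - 3 * Real.log (2 - t)) := by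
    rw [← l4, ← Real.exp_log (show 0 < 4 * t / (2 - t) ^ 3 by positivity),
      Real.log_div (by positivity) (by positivity), Real.log_mul (by positivity) (by positivity),
      Real.log_pow]
    norm_num
  dsimp only
  rw [abs_of_pos (by positivity), real_smul, e1, e2, e3, key t h0, key _ h3,
    key _ (by positivity), key _ (by positivity), key _ (by positivity), e4, ofReal_exp,
    show (2 : ℂ) = ((2 : ℝ) : ℂ) by norm_num, key 2 (by norm_num), Real.log_pow,
    Real.log_div h0.ne' h2.ne', Real.log_div h2.ne' (by norm_num),
    Real.log_div (by positivity) (by positivity), Real.log_mul (by positivity) h3.ne',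
    Real.log_pow, l4]
  simp only [← exp_add]
  congr 1
  push_cast
  ring

open Complex in
lemma hasSum_poch_mul_betaIntegral (a b v : ℂ) (hb : 0 < b.re) (hv : 0 < v.re) :
    HasSum (fun k : ℕ => poch a k / (k ! : ℂ) * (1 / 2) ^ k * betaIntegral (b + k) v)
      (∫ t : ℝ in 0..1, (t : ℂ) ^ (b - 1) * (1 - (t : ℂ)) ^ (v - 1) *
        (1 - (t : ℂ) / 2) ^ (-a)) := by
  have hconv := betaIntegral_convergent hb hv
  have hsum : Summable fun k : ℕ => ‖poch a k / (k ! : ℂ) * (1 / 2) ^ k‖ :=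
    (hasSum_one_sub_cpow_neg a (z := 1 / 2) (by norm_num)).summable.norm
  have h := intervalIntegral.hasSum_integral_of_dominated_convergence
    (μ := volume) (a := 0) (b := 1)
    (F := fun (k : ℕ) (t : ℝ) => (t : ℂ) ^ (b - 1) * (1 - (t : ℂ)) ^ (v - 1) *
      (poch a k / (k ! : ℂ) * ((t : ℂ) / 2) ^ k))
    (f := fun t : ℝ => (t : ℂ) ^ (b - 1) * (1 - (t : ℂ)) ^ (v - 1) * (1 - (t : ℂ) / 2) ^ (-a))
    (fun k t => ‖(t : ℂ) ^ (b - 1) * (1 - (t : ℂ)) ^ (v - 1)‖ *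
      ‖poch a k / (k ! : ℂ) * (1 / 2) ^ k‖)
    ?_ ?_ ?_ ?_ ?_
  · refine h.congr_fun fun k => ?_
    rw [betaIntegral, ← intervalIntegral.integral_const_mul,
      intervalIntegral.integral_of_le zero_le_one, intervalIntegral.integral_of_le zero_le_one]
    refine setIntegral_congr_fun measurableSet_Ioc fun t ht => ?_
    have ht0 : (t : ℂ) ≠ 0 := by exact_mod_cast ht.1.ne'
    rw [show b + k - 1 = b - 1 + k by ring, cpow_add _ _ ht0, cpow_natCast, div_pow, div_pow,
      one_pow]
    ring
  · intro k
    have h1 := hconv.aestronglyMeasurable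
    rw [← Set.uIoc_of_le zero_le_one] at h1
    refine h1.mul (Continuous.aestronglyMeasurable ?_)
    fun_prop
  · intro k
    refine Eventually.of_forall fun t ht => ?_
    rw [Set.uIoc_of_le zero_le_one] at ht
    rw [norm_mul _ (_ * _), norm_mul (_ / _), norm_mul (_ / _)]
    gcongr
    simp only [norm_pow]
    gcongr
    simp [abs_of_pos ht.1]
    linarith [ht.2]
  · exact Eventually.of_forall fun t _ => hsum.mul_left _
  · simp_rw [tsum_mul_left]
    exact hconv.norm.mul_const _
  · refine Eventually.of_forall fun t ht => ?_
    rw [Set.uIoc_of_le zero_le_one] at ht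
    refine (hasSum_one_sub_cpow_neg a ?_).mul_left _
    simp [abs_of_pos ht.1]
    linarith [ht.2]

open Complex in
lemma gaussSecondSum_eq_of_re_pos (a b : ℂ) (hb : 0 < b.re) (hab : 0 < (a - b + 1).re) :
    gaussSecondSum a b =
      Gamma (1 / 2) * (Gamma ((a + 1) / 2))⁻¹ * (Gamma ((b + 1) / 2))⁻¹ := by
  obtain ⟨v, hv⟩ : ∃ v, v = (a - b + 1) / 2 := ⟨_, rfl⟩
  have hvre : 0 < v.re := by rw [hv, div_ofNat_re]; positivity
  have hb2 : 0 < (b / 2).re := by rw [div_ofNat_re]; positivity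
  have ha : a = 2 * v + b - 1 := by rw [hv]; ring
  have hG (x : ℂ) (hx : 0 < x.re) : Gamma x ≠ 0 := Gamma_ne_zero_of_re_pos hx
  have h1 := hasSum_poch_mul_betaIntegral a b v hb hvre
  have h2 : (fun k : ℕ => poch a k / (k ! : ℂ) * (1 / 2) ^ k * betaIntegral (b + k) v) =
      fun k => Gamma b * Gamma v * regCoeff a b ((a + b + 1) / 2) k := by
    ext k
    have hbk : 0 < (b + k).re := by
      rw [add_re, natCast_re]; positivity
    have h3 := Gamma_mul_Gamma_eq_betaIntegral hbk hvre
    rw [show b + k + v = (a + b + 1) / 2 + k by rw [ha]; ring,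
      Gamma_add_nat_eq_poch (ne_neg_nat_of_re_pos hb)] at h3
    have h4 : Gamma ((a + b + 1) / 2 + k) ≠ 0 := by
      rw [show (a + b + 1) / 2 + k = b + k + v by rw [ha]; ring]
      exact hG _ (by rw [add_re]; positivity)
    have h5 : (k ! : ℂ) ≠ 0 := by exact_mod_cast k.factorial_ne_zero
    rw [regCoeff]
    generalize Gamma ((a + b + 1) / 2 + k) = G at *
    field_simp
    linear_combination -poch a k * h3
  rw [h2] at h1
  have h5 := integral_eq_betaIntegral b v
  rw [← ha] at h5
  rw [h5] at h1
  have h6 := h1.tsum_eq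
  rw [tsum_mul_left] at h6
  have h7 := Gamma_mul_Gamma_eq_betaIntegral hb2 hvre
  rw [show b / 2 + v = (a + 1) / 2 by rw [ha]; ring] at h7
  have h8 := Gamma_mul_Gamma_add_half (b / 2)
  have h9 : ((√Real.pi : ℝ) : ℂ) = Gamma (1 / 2) := by
    rw [← Real.Gamma_one_half_eq, ← Gamma_ofReal]
    norm_num
  rw [h9, show b / 2 + 1 / 2 = (b + 1) / 2 by ring, show 2 * (b / 2) = b by ring] at h8
  have g1 := hG b hb
  have g2 := hG v hvre
  have g3 : Gamma ((a + 1) / 2) ≠ 0 := by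
    rw [show (a + 1) / 2 = b / 2 + v by rw [ha]; ring]
    exact hG _ (by rw [add_re]; positivity)
  have g4 : Gamma ((b + 1) / 2) ≠ 0 := by
    rw [show (b + 1) / 2 = b / 2 + 1 / 2 by ring]
    exact hG _ (by rw [add_re]; norm_num; linarith)
  have g5 : (2 : ℂ) ^ (b - 1) * 2 ^ (1 - b) = 1 := by
    rw [← cpow_add _ _ two_ne_zero]; simp
  rw [← gaussSecondSum] at h6
  refine mul_left_cancel₀ (mul_ne_zero g1 g2) ?_
  rw [h6]
  field_simp
  linear_combination (-2 ^ (b - 1) * Gamma ((b + 1) / 2)) * h7 +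
    2 ^ (b - 1) * Gamma v * h8 + Gamma v * Gamma b * Gamma (1 / 2) * g5

open Complex in
lemma gaussSecondSum_eq_of_add_two (a b : ℂ)
    (h : gaussSecondSum (a + 2) b =
      Gamma (1 / 2) * (Gamma ((a + 2 + 1) / 2))⁻¹ * (Gamma ((b + 1) / 2))⁻¹) :
    gaussSecondSum a b =
      Gamma (1 / 2) * (Gamma ((a + 1) / 2))⁻¹ * (Gamma ((b + 1) / 2))⁻¹ := by
  rcases eq_or_ne a 0 with rfl | ha
  · rw [gaussSecondSum_zero_left, zero_add, mul_inv_cancel₀, one_mul]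
    exact Gamma_ne_zero_of_re_pos (by norm_num)
  · rw [gaussSecondSum_eq_mul_add_two a b ha, h, inv_Gamma_eq_mul ((a + 1) / 2),
      show (a + 2 + 1) / 2 = (a + 1) / 2 + 1 by ring]
    ring

open Complex in
lemma gaussSecondSum_eq_of_add_two_mul (n : ℕ) (a b : ℂ)
    (h : gaussSecondSum (a + 2 * n) b =
      Gamma (1 / 2) * (Gamma ((a + 2 * n + 1) / 2))⁻¹ * (Gamma ((b + 1) / 2))⁻¹) :
    gaussSecondSum a b =
      Gamma (1 / 2) * (Gamma ((a + 1) / 2))⁻¹ * (Gamma ((b + 1) / 2))⁻¹ := by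
  induction n with
  | zero => simpa using h
  | succ n ih =>
    refine ih (gaussSecondSum_eq_of_add_two _ _ ?_)
    rwa [show a + 2 * n + 2 = a + 2 * ((n + 1 : ℕ) : ℂ) by push_cast; ring]

open Complex in
/-- **Gauss's second summation theorem**, in regularized form. -/
lemma gaussSecondSum_eq (a b : ℂ) :
    gaussSecondSum a b =
      Gamma (1 / 2) * (Gamma ((a + 1) / 2))⁻¹ * (Gamma ((b + 1) / 2))⁻¹ := by
  obtain ⟨m, hm⟩ := exists_nat_gt (-b.re)
  rw [gaussSecondSum_comm, mul_right_comm]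
  refine gaussSecondSum_eq_of_add_two_mul m b a ?_
  rw [gaussSecondSum_comm, mul_right_comm]
  obtain ⟨n, hn⟩ := exists_nat_gt ((b + 2 * m - a).re)
  refine gaussSecondSum_eq_of_add_two_mul n a _ (gaussSecondSum_eq_of_re_pos _ _ ?_ ?_)
  · simp
    linarith [(Nat.cast_nonneg m : (0 : ℝ) ≤ m)]
  · simp at hn ⊢
    linarith [(Nat.cast_nonneg n : (0 : ℝ) ≤ n)]

lemma hyp_eq_regMoment (a b c d : ℂ) (hc : ∀ n : ℕ, c ≠ -(n : ℂ)) (hd : ∀ n : ℕ, d ≠ -(n : ℂ)) :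
    hyp [a, b, d + 1] [c, d] (1 / 2) =
      Complex.Gamma c * (regMoment a b c 0 + regMoment a b c 1 / d) := by
  have hd0 : d ≠ 0 := by simpa using hd 0
  have h := hasSum_quadratic_mul_regCoeff a b c 1 (1 / d) 0
  rw [one_mul, zero_mul, add_zero, one_div_mul_eq_div] at h
  rw [hyp, ← h.tsum_eq, ← tsum_mul_left]
  congr 1 with k
  have hdk : d + k ≠ 0 := fun h => hd k (eq_neg_of_add_eq_zero_left h)
  have h1 : poch d k ≠ 0 := by
    have := Gamma_add_nat_eq_poch hd k
    intro h0
    rw [h0, zero_mul] at this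
    refine Complex.Gamma_ne_zero (fun m hm => hd (k + m) ?_) this
    push_cast
    linear_combination hm
  have h2 := mul_poch_add_one d k
  have h3 := Gamma_add_nat_eq_poch hc k
  have h4 : Complex.Gamma c ≠ 0 := Complex.Gamma_ne_zero hc
  have h5 : Complex.Gamma (c + k) ≠ 0 := Complex.Gamma_ne_zero fun m hm => hc (k + m) (by
    push_cast
    linear_combination hm)
  have h6 : poch c k ≠ 0 := by
    rintro h0
    rw [h0, zero_mul] at h3
    exact h5 h3
  have h7 : (k ! : ℂ) ≠ 0 := by exact_mod_cast k.factorial_ne_zero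
  have h8 : poch (d + 1) k = poch d k * (d + k) / d := by rw [← h2]; field_simp
  simp only [List.map_cons, List.map_nil, List.prod_cons, List.prod_nil, mul_one]
  rw [regCoeff, h3, h8]
  field_simp
  ring

theorem extended_gauss_second_summation (a b d : ℂ) (hd : 0 < d.re)
    (h1 : ∀ n : ℕ, (a + b + 3) / 2 ≠ -(n : ℂ))
    (h2 : ∀ n : ℕ, (a - b - 1) / 2 ≠ -(n : ℂ)) :
    hyp [a, b, d + 1] [(a + b + 3) / 2, d] (1/2) =
      Complex.Gamma (1/2) * Complex.Gamma ((a + b + 3) / 2) *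
        Complex.Gamma ((a - b - 1) / 2) / Complex.Gamma ((a - b + 3) / 2) *
        (((a + b - 1) / 2 - a * b / d) /
            (Complex.Gamma ((a + 1) / 2) * Complex.Gamma ((b + 1) / 2)) +
          ((a + b + 1) / d - 2) / (Complex.Gamma (a / 2) * Complex.Gamma (b / 2))) := by
  have hd' := ne_neg_nat_of_re_pos hd
  have hd0 : d ≠ 0 := by simpa using hd' 0
  have e1 : a - b - 1 ≠ 0 := fun h => h2 0 (by rw [h]; simp)
  have e2 : a - b + 1 ≠ 0 := fun h => h2 1 (by push_cast; linear_combination h / 2)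
  have hΓ : Complex.Gamma ((a - b + 3) / 2) =
      (a - b + 1) / 2 * ((a - b - 1) / 2 * Complex.Gamma ((a - b - 1) / 2)) := by
    rw [← Complex.Gamma_add_one _ (div_ne_zero e1 two_ne_zero),
      show (a - b - 1) / 2 + 1 = (a - b + 1) / 2 by ring,
      ← Complex.Gamma_add_one _ (div_ne_zero e2 two_ne_zero)]
    congr 1
    ring
  have hΓ0 : Complex.Gamma ((a - b - 1) / 2) ≠ 0 := Complex.Gamma_ne_zero h2
  rw [hyp_eq_regMoment a b _ d h1 hd', hΓ]
  have m0 := regMoment_relation a b ((a + b + 1) / 2)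
  have m1 := gaussSecondSum_eq_regMoment a b
  have m2 := mul_gaussSecondSum_add_one_add_one a b
  rw [gaussSecondSum_eq] at m1 m2
  rw [show (a + b + 1) / 2 + 1 = (a + b + 3) / 2 by ring] at m0 m1 m2
  have ha := inv_Gamma_eq_mul (a / 2)
  have hb := inv_Gamma_eq_mul (b / 2)
  rw [show a / 2 + 1 = (a + 1 + 1) / 2 by ring] at ha
  rw [show b / 2 + 1 = (b + 1 + 1) / 2 by ring] at hb
  have m3 : 4 * Complex.Gamma (1 / 2) * (Complex.Gamma (a / 2))⁻¹ * (Complex.Gamma (b / 2))⁻¹ =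
      a * b * regMoment a b ((a + b + 3) / 2) 0 + (a + b) * regMoment a b ((a + b + 3) / 2) 1 +
        regMoment a b ((a + b + 3) / 2) 2 := by
    rw [← m2, ha, hb]
    ring
  rw [div_eq_mul_inv _ (Complex.Gamma _ * _), div_eq_mul_inv _ (Complex.Gamma _ * _), mul_inv,
    mul_inv]
  generalize (Complex.Gamma (a / 2))⁻¹ = A at *
  generalize (Complex.Gamma (b / 2))⁻¹ = B at *
  generalize (Complex.Gamma ((a + 1) / 2))⁻¹ = A' at *
  generalize (Complex.Gamma ((b + 1) / 2))⁻¹ = B' at *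
  generalize regMoment a b ((a + b + 3) / 2) 0 = s0 at *
  generalize regMoment a b ((a + b + 3) / 2) 1 = s1 at *
  generalize regMoment a b ((a + b + 3) / 2) 2 = s2 at *
  have k0 : (a - b + 1) * (a - b - 1) * s0 = 4 * Complex.Gamma (1 / 2) *
      ((a + b - 1) / 2 * (A' * B') - 2 * (A * B)) := by
    linear_combination -2 * (a + b - 1) * m1 + 2 * m3 - 4 * m0
  have k1 : (a - b + 1) * (a - b - 1) * s1 = 4 * Complex.Gamma (1 / 2) *
      (-(a * b) * (A' * B') + (a + b + 1) * (A * B)) := by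
    linear_combination 4 * a * b * m1 - (a + b + 1) * m3 + 2 * (a + b + 1) * m0
  field_simp
  linear_combination Complex.Gamma ((a + b + 3) / 2) * (d * k0 + k1)
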